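/- Let X and E be finite-dimensional real normed spaces and f : S_X → S_E a bijective isometry, and let y ∈ S_X. Then there exists a linear isomorphism T from span Λ_y onto span Λ_{f(y)} that represents the tangent action of f at y, i.e. for every sequence (y_n) in S_X \ {y} converging to y with (y − y_n)/‖y − y_n‖ → u, one has (f(y) − f(y_n))/‖f(y) − f(y_n)‖ → T(u). -/

import Mathlib

open Filter Topology Metric Set MeasureTheory

noncomputable section

/-- The normalized direction `v / ‖v‖` of a vector (equal to `0` when `v = 0`). -/
def unitDir {X : Type*} [NormedAddCommGroup X] [NormedSpace ℝ X] (v : X) : X := ‖v‖⁻¹ • v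

/-- The set `ℷ(x)` of support functionals at a point `x` of the unit sphere:
functionals of norm one attaining the value `1` at `x`. -/
def suppFn (X : Type*) [NormedAddCommGroup X] [NormedSpace ℝ X] (x : X) :
    Set (X →L[ℝ] ℝ) := {g | ‖g‖ = 1 ∧ g x = 1}

/-- A point of the unit sphere is smooth if it has exactly one support functional. -/
def IsSmoothPt {X : Type*} [NormedAddCommGroup X] [NormedSpace ℝ X] (x : X) : Prop :=
  ∃ g : X →L[ℝ] ℝ, suppFn X x = {g}

/-- `D_y = {x ∈ S_X : ‖x + y‖ < 2}`. -/
def Dset {X : Type*} [NormedAddCommGroup X] [NormedSpace ℝ X] (y : X) : Set X :=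
  {x | x ∈ sphere (0 : X) 1 ∧ ‖x + y‖ < 2}

/-- `W_y`: points `x ∈ D_y` with `(x-y)/‖x-y‖` smooth in `X` and
`(f x - f y)/‖f x - f y‖` smooth in `E`. -/
def Wset {X E : Type*} [NormedAddCommGroup X] [NormedSpace ℝ X]
    [NormedAddCommGroup E] [NormedSpace ℝ E] (f : X → E) (y : X) : Set X :=
  {x | x ∈ Dset y ∧ IsSmoothPt (unitDir (x - y)) ∧ IsSmoothPt (unitDir (f x - f y))}

/-- `Λ_y`: the set of limit points of `(y - z)/‖y - z‖` as `z → y`, `z ∈ S_X`, `z ≠ y`. -/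
def tangentDirs {X : Type*} [NormedAddCommGroup X] [NormedSpace ℝ X] (y : X) : Set X :=
  {u | ∃ z : ℕ → X, (∀ n, z n ∈ sphere (0 : X) 1 ∧ z n ≠ y) ∧
    Tendsto z atTop (𝓝 y) ∧ Tendsto (fun n => unitDir (y - z n)) atTop (𝓝 u)}

/-- A linear map `T` represents the tangent action of `f` at `y`: whenever `y_n → y` on the
sphere with `(y - y_n)/‖y - y_n‖ → u`, one has `(f y - f y_n)/‖f y - f y_n‖ → T u`. -/
def RepTangent {X E : Type*} [NormedAddCommGroup X] [NormedSpace ℝ X]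
    [NormedAddCommGroup E] [NormedSpace ℝ E] (f : X → E) (y : X) (T : X →ₗ[ℝ] E) : Prop :=
  ∀ (z : ℕ → X) (u : X), (∀ n, z n ∈ sphere (0 : X) 1 ∧ z n ≠ y) →
    Tendsto z atTop (𝓝 y) → Tendsto (fun n => unitDir (y - z n)) atTop (𝓝 u) →
    Tendsto (fun n => unitDir (f y - f (z n))) atTop (𝓝 (T u))

/-- The positively homogeneous extension `F` of `f`: `F 0 = 0`, `F x = ‖x‖ • f (x/‖x‖)`. -/
def homExt {X E : Type*} [NormedAddCommGroup X] [NormedSpace ℝ X]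
    [NormedAddCommGroup E] [NormedSpace ℝ E] (f : X → E) (x : X) : E :=
  ‖x‖ • f (unitDir x)

/-- `F` is Gateaux differentiable at `y`: all one-sided directional derivatives exist and
depend linearly (and continuously) on the direction. -/
def GateauxAt {X E : Type*} [NormedAddCommGroup X] [NormedSpace ℝ X]
    [NormedAddCommGroup E] [NormedSpace ℝ E] (F : X → E) (y : X) : Prop :=
  ∃ L : X →L[ℝ] E, ∀ z : X,
    Tendsto (fun a : ℝ => a⁻¹ • (F (y + a • z) - F y)) (𝓝[>] 0) (𝓝 (L z))

section NormDifferentiability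

variable {V : Type*} [NormedAddCommGroup V] [NormedSpace ℝ V]

/-- The norm of `V` is differentiable at `d` up to an error of relative size `ε`. -/
def almostSmooth (V : Type*) [NormedAddCommGroup V] [NormedSpace ℝ V] (ε : ℝ) : Set V :=
  {d | ∃ t > 0, ∃ c < ε * t, ∀ w : V, ‖w‖ ≤ 1 → ‖d + t • w‖ + ‖d - t • w‖ ≤ 2 * ‖d‖ + c}

lemma isOpen_almostSmooth (ε : ℝ) : IsOpen (almostSmooth V ε) := by
  rw [Metric.isOpen_iff]
  rintro d ⟨t, ht, c, hc, h⟩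
  refine ⟨(ε * t - c) / 8, by linarith, fun e he => ⟨t, ht, c + (ε * t - c) / 2, by linarith, ?_⟩⟩
  intro w hw
  rw [mem_ball, dist_eq_norm] at he
  have h1 : ‖e + t • w‖ ≤ ‖d + t • w‖ + ‖e - d‖ :=
    (norm_add_le (d + t • w) (e - d)).trans_eq' (by congr 1; abel)
  have h2 : ‖e - t • w‖ ≤ ‖d - t • w‖ + ‖e - d‖ :=
    (norm_add_le (d - t • w) (e - d)).trans_eq' (by congr 1; abel)
  have h3 : ‖d‖ - ‖e‖ ≤ ‖e - d‖ := norm_sub_rev e d ▸ norm_sub_norm_le d e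
  linarith [h w hw]

lemma DifferentiableAt.mem_almostSmooth {d : V} (hd : DifferentiableAt ℝ (‖·‖) d) {ε : ℝ}
    (hε : 0 < ε) : d ∈ almostSmooth V ε := by
  have h := hd.hasFDerivAt
  set g := fderiv ℝ (‖·‖) d
  rw [hasFDerivAt_iff_isLittleO_nhds_zero, Asymptotics.isLittleO_iff] at h
  obtain ⟨δ, hδ, hb⟩ := Metric.eventually_nhds_iff.1 (h (show 0 < ε / 4 by positivity))
  have key : ∀ w : V, ‖w‖ ≤ 1 →
      ‖d + (δ / 2) • w‖ ≤ ‖d‖ + g ((δ / 2) • w) + ε / 4 * (δ / 2) := by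
    intro w hw
    have hn : ‖(δ / 2) • w‖ ≤ δ / 2 := by
      rw [norm_smul, Real.norm_of_nonneg (by positivity)]
      exact mul_le_of_le_one_right (by positivity) hw
    have h1 := (abs_le.1 (hb (y := (δ / 2) • w) (by rw [dist_zero_right]; linarith))).2
    have h2 : ε / 4 * ‖(δ / 2) • w‖ ≤ ε / 4 * (δ / 2) := by gcongr
    linarith
  refine ⟨δ / 2, by positivity, ε / 2 * (δ / 2), by nlinarith [mul_pos hε hδ], fun w hw => ?_⟩
  have h1 := key w hw
  have h2 := key (-w) (by rwa [norm_neg])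
  rw [smul_neg, ← sub_eq_add_neg, map_neg] at h2
  linarith

lemma differentiableAt_norm_of_mem_almostSmooth {d : V}
    (hd : ∀ k : ℕ, d ∈ almostSmooth V (1 / (k + 1))) : DifferentiableAt ℝ (‖·‖) d := by
  obtain ⟨g, hg1, hgd⟩ := exists_dual_vector'' ℝ d
  have hle : ∀ v, g v ≤ ‖v‖ := fun v =>
    (le_abs_self _).trans ((g.le_opNorm v).trans (mul_le_of_le_one_left (norm_nonneg v) hg1))
  replace hgd : g d = ‖d‖ := hgd
  refine HasFDerivAt.differentiableAt (f' := g) ?_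
  rw [hasFDerivAt_iff_isLittleO_nhds_zero, Asymptotics.isLittleO_iff]
  intro ε hε
  obtain ⟨k, hk⟩ := exists_nat_one_div_lt hε
  obtain ⟨t, ht, c, hc, h⟩ := hd k
  refine Metric.eventually_nhds_iff.2 ⟨t, ht, fun {v} hv => ?_⟩
  rw [dist_zero_right] at hv
  have hlow := hle (d + v)
  rw [map_add, hgd] at hlow
  rw [Real.norm_of_nonneg (by linarith)]
  rcases eq_or_ne v 0 with rfl | hv0
  · simp
  have ha : 0 < ‖v‖ := norm_pos_iff.2 hv0
  set a := ‖v‖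
  set w := a⁻¹ • v
  have hw : ‖w‖ = 1 := norm_smul_inv_norm (𝕜 := ℝ) hv0
  have haw : v = a • w := by simp [w, smul_smul, ha.ne']
  have h1 := h w hw.le
  have h2 := hle (d - t • w)
  rw [map_sub, hgd, map_smul, smul_eq_mul] at h2
  have hgv : g v = a * g w := by rw [haw, map_smul, smul_eq_mul]
  have hr : a / t * t = a := by field_simp
  have hr1 : a / t ≤ 1 := (div_le_one ht).2 hv.le
  have h3 : ‖d + v‖ ≤ (1 - a / t) * ‖d‖ + a / t * ‖d + t • w‖ := by
    have : d + v = (1 - a / t) • d + (a / t) • (d + t • w) := by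
      rw [smul_add, smul_smul, hr, ← haw, sub_smul, one_smul]; abel
    rw [this]
    refine (norm_add_le _ _).trans_eq ?_
    rw [norm_smul, norm_smul, Real.norm_of_nonneg (by linarith), Real.norm_of_nonneg (by positivity)]
  have h4 : a / t * ‖d + t • w‖ ≤ a / t * (‖d‖ + t * g w + 1 / (k + 1) * t) := by
    gcongr; linarith
  have h5 : a / t * (‖d‖ + t * g w + 1 / (k + 1) * t) =
      a / t * ‖d‖ + a * g w + 1 / (k + 1) * a := by
    linear_combination (g w + 1 / ((k : ℝ) + 1)) * hr
  have h6 : 1 / ((k : ℝ) + 1) * a ≤ ε * a := by gcongr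
  linarith

lemma isGδ_setOf_differentiableAt_norm : IsGδ {d : V | DifferentiableAt ℝ (‖·‖) d} := by
  have : {d : V | DifferentiableAt ℝ (‖·‖) d} = ⋂ k : ℕ, almostSmooth V (1 / (k + 1)) := by
    ext d
    rw [mem_iInter]
    exact ⟨fun h k => h.mem_almostSmooth Nat.one_div_pos_of_nat,
      differentiableAt_norm_of_mem_almostSmooth⟩
  rw [this]
  exact .iInter_of_isOpen fun k => isOpen_almostSmooth _

end NormDifferentiability

section Chords

variable {V : Type*} [NormedAddCommGroup V] [NormedSpace ℝ V]

lemma norm_add_smul_le (y d : V) (r s : ℝ) {a b : ℝ} (ha : 0 ≤ a) (hb : 0 ≤ b) (hab : a + b = 1) :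
    ‖y + (a * r + b * s) • d‖ ≤ a * ‖y + r • d‖ + b * ‖y + s • d‖ := by
  obtain rfl : a = 1 - b := by linarith
  have e : y + ((1 - b) * r + b * s) • d = (1 - b) • (y + r • d) + b • (y + s • d) := by module
  rw [e]
  refine (norm_add_le _ _).trans_eq ?_
  rw [norm_smul, norm_smul, Real.norm_of_nonneg ha, Real.norm_of_nonneg hb]

lemma continuous_norm_add_smul (y d : V) : Continuous fun r : ℝ => ‖y + r • d‖ := by fun_prop

/-- A ray from a boundary point `y` entering the open unit ball leaves it at a point of `D_y`. -/
lemma exists_add_smul_mem_Dset {y d : V} (hy : ‖y‖ = 1) {s : ℝ} (hs : 0 < s)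
    (h : ‖y + s • d‖ < 1) : ∃ r > (0 : ℝ), y + r • d ∈ Dset y := by
  have hd : d ≠ 0 := by rintro rfl; simp [hy] at h
  have hd' := norm_pos_iff.2 hd
  have hbig : 1 ≤ ‖y + (s + 2 / ‖d‖) • d‖ := by
    have h1 : ‖(s + 2 / ‖d‖) • d‖ = s * ‖d‖ + 2 := by
      rw [norm_smul, Real.norm_of_nonneg (by positivity)]; field_simp
    have h2 := norm_sub_norm_le ((s + 2 / ‖d‖) • d) (-y)
    rw [sub_neg_eq_add, norm_neg, h1, hy, add_comm _ y] at h2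
    nlinarith [mul_pos hs hd']
  obtain ⟨r, ⟨hr, -⟩, hr1⟩ := intermediate_value_Icc (show s ≤ s + 2 / ‖d‖ by simp; positivity)
    (continuous_norm_add_smul y d).continuousOn ⟨h.le, hbig⟩
  have hr1 : ‖y + r • d‖ = 1 := hr1
  have hr0 : 0 < r := hs.trans_le hr
  have hsr : s < r := lt_of_le_of_ne hr (by rintro rfl; linarith)
  refine ⟨r, hr0, by simpa using hr1, ?_⟩
  have hhalf : ‖y + (r / 2) • d‖ < 1 := by
    rcases le_or_gt (r / 2) s with hle | hgt
    · have := norm_add_smul_le y d 0 s (a := 1 - r / 2 / s) (b := r / 2 / s)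
        (by rw [sub_nonneg, div_le_one hs]; exact hle) (by positivity) (by ring)
      have e : (1 - r / 2 / s) * 0 + r / 2 / s * s = r / 2 := by
        field_simp; ring
      rw [e, zero_smul, add_zero, hy] at this
      have : r / 2 / s * ‖y + s • d‖ < r / 2 / s * 1 := by gcongr
      linarith
    · have hrs : 0 < r - s := sub_pos.2 hsr
      have := norm_add_smul_le y d s r (a := (r - r / 2) / (r - s))
        (b := (r / 2 - s) / (r - s)) (by apply div_nonneg <;> linarith)
        (by apply div_nonneg <;> linarith) (by field_simp; ring)
      have e : (r - r / 2) / (r - s) * s + (r / 2 - s) / (r - s) * r = r / 2 := by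
        field_simp; ring
      rw [e, hr1] at this
      have h7 : (r - r / 2) / (r - s) * ‖y + s • d‖ < (r - r / 2) / (r - s) * 1 := by
        have : 0 < r - r / 2 := by linarith
        gcongr
      have h8 : (r - r / 2) / (r - s) + (r / 2 - s) / (r - s) = 1 := by field_simp; ring
      linarith
  have e : y + r • d + y = (2 : ℝ) • (y + (r / 2) • d) := by module
  rw [e, norm_smul, Real.norm_ofNat]
  linarith

/-- Near a point `x ∈ D_y` the central projection from `y` onto the sphere is continuous. -/
lemma eventually_exists_add_smul_mem_sphere {y x : V} (hx : x ∈ Dset y) {ε : ℝ} (hε : 0 < ε)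
    (hε' : ε ≤ 1 / 2) :
    ∀ᶠ d in 𝓝 (x - y), ∃ s ∈ Icc (1 - ε) (1 + ε), ‖y + s • d‖ = 1 := by
  have hx1 : ‖y + (1 : ℝ) • (x - y)‖ = 1 := by simpa using hx.1
  have hhalf : ‖y + (1 / 2 : ℝ) • (x - y)‖ < 1 := by
    have e : y + (1 / 2 : ℝ) • (x - y) = (1 / 2 : ℝ) • (x + y) := by module
    rw [e, norm_smul]
    have := hx.2
    norm_num
    linarith
  have hlow : ‖y + (1 - ε) • (x - y)‖ < 1 := by
    have := norm_add_smul_le y (x - y) (1 / 2) 1 (a := 2 * ε) (b := 1 - 2 * ε)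
      (by positivity) (by linarith) (by ring)
    have e : 2 * ε * (1 / 2) + (1 - 2 * ε) * 1 = 1 - ε := by
      ring
    rw [e, hx1] at this
    nlinarith
  have hhigh : 1 < ‖y + (1 + ε) • (x - y)‖ := by
    have := norm_add_smul_le y (x - y) (1 / 2) (1 + ε) (a := ε / (1 / 2 + ε))
      (b := (1 / 2) / (1 / 2 + ε)) (by positivity) (by positivity) (by field_simp; ring)
    have e : ε / (1 / 2 + ε) * (1 / 2) + (1 / 2) / (1 / 2 + ε) * (1 + ε) = 1 := by
      field_simp; ring
    rw [e, hx1] at this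
    have h7 : ε / (1 / 2 + ε) * ‖y + (1 / 2 : ℝ) • (x - y)‖ < ε / (1 / 2 + ε) * 1 := by gcongr
    have h8 : ε / (1 / 2 + ε) + (1 / 2) / (1 / 2 + ε) = 1 := by field_simp; ring
    have h9 : (1 / 2) / (1 / 2 + ε) * 1 <
        (1 / 2) / (1 / 2 + ε) * ‖y + (1 + ε) • (x - y)‖ := by linarith
    exact lt_of_mul_lt_mul_left h9 (by positivity)
  have c1 : Continuous fun d : V => ‖y + (1 - ε) • d‖ := by fun_prop
  have c2 : Continuous fun d : V => ‖y + (1 + ε) • d‖ := by fun_prop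
  filter_upwards [c1.continuousAt.eventually_lt_const hlow,
    c2.continuousAt.eventually_const_lt hhigh] with d h1 h2
  exact intermediate_value_Icc (by linarith) (continuous_norm_add_smul y d).continuousOn
    ⟨h1.le, h2.le⟩

lemma dense_differentiableAt_norm_sub [FiniteDimensional ℝ V] (y : V) :
    Dense {x : Dset y | DifferentiableAt ℝ (‖·‖) (x.1 - y)} := by
  rw [Metric.dense_iff]
  rintro ⟨x, hx⟩ ρ hρ
  have hsmall : Tendsto (fun ε : ℝ => ε * (‖x - y‖ + ε) + ε) (𝓝[>] 0) (𝓝 0) := by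
    have : Continuous fun ε : ℝ => ε * (‖x - y‖ + ε) + ε := by fun_prop
    exact (this.tendsto' 0 0 (by simp)).mono_left nhdsWithin_le_nhds
  obtain ⟨ε, ⟨hε, hε3⟩, hε0⟩ := (((hsmall.eventually_lt_const
    (show 0 < min ρ (2 - ‖x + y‖) from lt_min hρ (sub_pos.2 hx.2))).and
    (nhdsWithin_le_nhds (eventually_le_nhds (show (0 : ℝ) < 1 / 2 by norm_num)))).and
    self_mem_nhdsWithin).exists
  obtain ⟨hε1, hε2⟩ := lt_min_iff.1 hε
  replace hε0 : 0 < ε := hε0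
  obtain ⟨d, hdG, ⟨s, hs, hs1⟩, hdε⟩ := ((dense_differentiableAt_norm (E := V)).inter_nhds_nonempty
    ((eventually_exists_add_smul_mem_sphere hx hε0 hε3).and (ball_mem_nhds _ hε0)))
  have hdist : ‖y + s • d - x‖ ≤ ε * (‖x - y‖ + ε) + ε := by
    rw [dist_eq_norm] at hdε
    have e : y + s • d - x = (s - 1) • d + (d - (x - y)) := by module
    have h1 : ‖d‖ ≤ ‖x - y‖ + ε := by linarith [norm_sub_norm_le d (x - y)]
    have h2 : |s - 1| ≤ ε := abs_le.2 ⟨by linarith [hs.1], by linarith [hs.2]⟩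
    rw [e]
    refine (norm_add_le _ _).trans ?_
    rw [norm_smul, Real.norm_eq_abs]
    gcongr
  refine ⟨⟨y + s • d, by simpa using hs1, ?_⟩, ?_, ?_⟩
  · have e : y + s • d + y = (y + s • d - x) + (x + y) := by abel
    rw [e]
    linarith [norm_add_le (y + s • d - x) (x + y)]
  · rw [mem_ball, Subtype.dist_eq, dist_eq_norm]
    exact hdist.trans_lt hε1
  · have hs0 : s ≠ 0 := by linarith [hs.1]
    simpa using (differentiableAt_norm_smul hs0).1 hdG

lemma isGδ_differentiableAt_norm_sub (y : V) :
    IsGδ {x : Dset y | DifferentiableAt ℝ (‖·‖) (x.1 - y)} :=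
  isGδ_setOf_differentiableAt_norm.preimage (f := fun x : Dset y => x.1 - y) (by fun_prop)

lemma isLocallyClosed_Dset (y : V) : IsLocallyClosed (Dset y) :=
  isClosed_sphere.isLocallyClosed.inter
    (isOpen_lt (by fun_prop : Continuous fun x : V => ‖x + y‖) continuous_const).isLocallyClosed

/-- The derivatives of the norm at `x - y`, for `x` in a dense subset of `D_y`, separate points. -/
lemma eq_zero_of_fderiv_norm_sub_eq_zero {y w : V} (hy : ‖y‖ = 1) {W : Set (Dset y)}
    (hW : Dense W) (hdiff : ∀ x ∈ W, DifferentiableAt ℝ (‖·‖) (x.1 - y))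
    (hw : ∀ x ∈ W, fderiv ℝ (‖·‖) (x.1 - y) w = 0) : w = 0 := by
  have hD : ∀ x : Dset y, ∀ t : ℝ, ‖x.1 - y‖ ≤ ‖x.1 - y - t • w‖ := by
    intro x t
    have hcl : IsClosed {x : Dset y | ‖x.1 - y‖ ≤ ‖x.1 - y - t • w‖} :=
      isClosed_le (by fun_prop) (by fun_prop)
    refine (hcl.closure_subset_iff.2 fun x hx => ?_) (hW x)
    have h1 : ‖fderiv ℝ (‖·‖) (x.1 - y)‖ ≤ 1 := by
      simpa using norm_fderiv_le_of_lipschitz ℝ (lipschitzWith_one_norm (E := V))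
    have h2 := (le_abs_self _).trans
      ((fderiv ℝ (‖·‖) (x.1 - y)).le_of_opNorm_le h1 (x.1 - y - t • w))
    rwa [map_sub, map_smul, hw x hx, smul_zero, sub_zero, (hdiff x hx).fderiv_norm_self,
      one_mul] at h2
  have hK : ∀ d : V, ∀ s > (0 : ℝ), ‖y + s • d‖ < 1 → ∀ t : ℝ, ‖d‖ ≤ ‖d - t • w‖ := by
    intro d s hs h t
    obtain ⟨r, hr, hrD⟩ := exists_add_smul_mem_Dset hy hs h
    have h1 := hD ⟨_, hrD⟩ (r * t)
    rw [add_sub_cancel_left, mul_smul, ← smul_sub, norm_smul, norm_smul] at h1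
    exact le_of_mul_le_mul_left h1 (norm_pos_iff.2 hr.ne')
  obtain ⟨r, hr0, hr⟩ : ∃ r > (0 : ℝ), ‖y + r • w‖ ≤ 1 := by
    have hc : Continuous fun r : ℝ => ‖y + (1 : ℝ) • (-y - r • w)‖ := by fun_prop
    have : ∀ᶠ r in 𝓝[>] (0 : ℝ), ‖y + (1 : ℝ) • (-y - r • w)‖ < 1 :=
      nhdsWithin_le_nhds (hc.continuousAt.eventually_lt_const (by simp))
    obtain ⟨r, h, hr0⟩ := (this.and self_mem_nhdsWithin).exists
    refine ⟨r, hr0, ?_⟩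
    have h1 := hK _ 1 one_pos h (-r)
    have e1 : -y - r • w = -(y + r • w) := by abel
    have e2 : -(y + r • w) - (-r) • w = -y := by module
    rwa [e1, e2, norm_neg, norm_neg, hy] at h1
  have hbound : ∀ t > (0 : ℝ), t * ‖w‖ ≤ 2 := by
    intro t ht
    have hs : 0 < r / (t + r) := by positivity
    have hmem : ‖y + (r / (t + r)) • (-y + t • w)‖ < 1 := by
      have e : y + (r / (t + r)) • (-y + t • w) = (t / (t + r)) • (y + r • w) := by
        have h1 : t / (t + r) = 1 - r / (t + r) := by field_simp; ring
        have h2 : t / (t + r) * r = r / (t + r) * t := by ring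
        rw [smul_add, smul_add, smul_smul, smul_smul, h2, h1]; module
      rw [e, norm_smul, Real.norm_of_nonneg (by positivity)]
      have h1 : t / (t + r) < 1 := by rw [div_lt_one (by positivity)]; linarith
      calc t / (t + r) * ‖y + r • w‖ ≤ t / (t + r) * 1 := by gcongr
        _ < 1 := by linarith
    have h1 := hK _ _ hs hmem t
    rw [add_sub_cancel_right, norm_neg, hy] at h1
    have h2 := norm_sub_norm_le (t • w) y
    rw [norm_smul, Real.norm_of_nonneg ht.le, hy] at h2
    have e : t • w - y = -y + t • w := by abel
    rw [e] at h2
    linarith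
  by_contra hne
  have hpos := norm_pos_iff.2 hne
  have := hbound (3 / ‖w‖) (by positivity)
  rw [div_mul_cancel₀ _ hpos.ne'] at this
  norm_num at this

end Chords

section Antipodes

variable {V : Type*} [NormedAddCommGroup V] [NormedSpace ℝ V]

/-- A metric characterization of the relation `‖x + y‖ = 2` on the unit sphere. -/
lemma norm_add_eq_two_iff {x y : V} (hx : x ∈ sphere (0 : V) 1) (hy : y ∈ sphere (0 : V) 1) :
    ‖x + y‖ = 2 ↔ ∃ p ∈ sphere (0 : V) 1, ∀ z ∈ sphere (0 : V) 1,
      ‖z - p‖ = 2 → ‖z - x‖ = 2 ∧ ‖z - y‖ = 2 := by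
  simp only [mem_sphere_zero_iff_norm] at hx hy ⊢
  constructor
  · intro h
    have hp : ‖(1 / 2 : ℝ) • (x + y)‖ = 1 := by rw [norm_smul, h]; norm_num
    refine ⟨_, hp, fun z hz hzp => ?_⟩
    have e : (2 : ℝ) • (z - (1 / 2 : ℝ) • (x + y)) = (z - x) + (z - y) := by module
    have h1 := norm_add_le (z - x) (z - y)
    rw [← e, norm_smul, hzp, Real.norm_ofNat] at h1
    have h2 := norm_sub_le z x
    have h3 := norm_sub_le z y
    constructor <;> linarith
  · rintro ⟨p, hp, h⟩
    have h1 := (h (-p) (by rwa [norm_neg]) (by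
      rw [show -p - p = (-2 : ℝ) • p by module, norm_smul, hp]; norm_num)).1
    have h2 := (h (-x) (by rwa [norm_neg]) (by
      rw [← h1]; congr 1; abel)).2
    rw [← h2, ← norm_neg]
    congr 1; abel

end Antipodes

lemma tendsto_map_iff {X E : Type*} [NormedAddCommGroup X] [NormedAddCommGroup E] {f : X → E} {y : X}
    (hiso : ∀ x ∈ sphere (0 : X) 1, ∀ x' ∈ sphere (0 : X) 1,
      ‖f x - f x'‖ = ‖x - x'‖) (hy : y ∈ sphere (0 : X) 1) {z : ℕ → X}
    (hz : ∀ n, z n ∈ sphere (0 : X) 1) :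
    Tendsto (fun n => f (z n)) atTop (𝓝 (f y)) ↔ Tendsto z atTop (𝓝 y) := by
  rw [tendsto_iff_norm_sub_tendsto_zero, tendsto_iff_norm_sub_tendsto_zero (f := z)]
  simp only [hiso _ (hz _) y hy]

section SphereIsometry

variable {X E : Type*} [NormedAddCommGroup X] [NormedSpace ℝ X]
  [NormedAddCommGroup E] [NormedSpace ℝ E] {f : X → E} {y : X}

lemma norm_map_add_map_eq_two_iff (hbij : BijOn f (sphere (0 : X) 1) (sphere (0 : E) 1))
    (hiso : ∀ x ∈ sphere (0 : X) 1, ∀ x' ∈ sphere (0 : X) 1, ‖f x - f x'‖ = ‖x - x'‖)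
    {x : X} (hx : x ∈ sphere (0 : X) 1) (hy : y ∈ sphere (0 : X) 1) :
    ‖f x + f y‖ = 2 ↔ ‖x + y‖ = 2 := by
  rw [norm_add_eq_two_iff hx hy, norm_add_eq_two_iff (hbij.mapsTo hx) (hbij.mapsTo hy)]
  constructor
  · rintro ⟨q, hq, h⟩
    obtain ⟨p, hp, rfl⟩ := hbij.surjOn hq
    refine ⟨p, hp, fun z hz hzp => ?_⟩
    rw [← hiso z hz p hp] at hzp
    rw [← hiso z hz x hx, ← hiso z hz y hy]
    exact h _ (hbij.mapsTo hz) hzp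
  · rintro ⟨p, hp, h⟩
    refine ⟨f p, hbij.mapsTo hp, fun z' hz' hzp => ?_⟩
    obtain ⟨z, hz, rfl⟩ := hbij.surjOn hz'
    rw [hiso z hz p hp] at hzp
    rw [hiso z hz x hx, hiso z hz y hy]
    exact h z hz hzp

lemma bijOn_Dset (hbij : BijOn f (sphere (0 : X) 1) (sphere (0 : E) 1))
    (hiso : ∀ x ∈ sphere (0 : X) 1, ∀ x' ∈ sphere (0 : X) 1, ‖f x - f x'‖ = ‖x - x'‖)
    (hy : y ∈ sphere (0 : X) 1) : BijOn f (Dset y) (Dset (f y)) := by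
  have hlt : ∀ x ∈ sphere (0 : X) 1, (‖f x + f y‖ < 2 ↔ ‖x + y‖ < 2) := by
    intro x hx
    have h1 : ‖x + y‖ ≤ 2 := (norm_add_le x y).trans_eq (by
      rw [mem_sphere_zero_iff_norm.1 hx, mem_sphere_zero_iff_norm.1 hy]; norm_num)
    have h2 : ‖f x + f y‖ ≤ 2 := (norm_add_le _ _).trans_eq (by
      rw [mem_sphere_zero_iff_norm.1 (hbij.mapsTo hx),
        mem_sphere_zero_iff_norm.1 (hbij.mapsTo hy)]; norm_num)
    rw [h1.lt_iff_ne, h2.lt_iff_ne, Ne, Ne, norm_map_add_map_eq_two_iff hbij hiso hx hy]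
  refine ⟨fun x hx => ⟨hbij.mapsTo hx.1, (hlt x hx.1).2 hx.2⟩,
    hbij.injOn.mono fun x hx => hx.1, ?_⟩
  rintro _ ⟨hx', hlt'⟩
  obtain ⟨x, hx, rfl⟩ := hbij.surjOn hx'
  exact ⟨x, ⟨hx, (hlt x hx).1 hlt'⟩, rfl⟩

lemma exists_dense_differentiableAt_norm [FiniteDimensional ℝ X] [FiniteDimensional ℝ E]
    (hbij : BijOn f (sphere (0 : X) 1) (sphere (0 : E) 1))
    (hiso : ∀ x ∈ sphere (0 : X) 1, ∀ x' ∈ sphere (0 : X) 1, ‖f x - f x'‖ = ‖x - x'‖)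
    (hy : y ∈ sphere (0 : X) 1) :
    ∃ (e : Dset y ≃ₜ Dset (f y)) (W : Set (Dset y)), (∀ x, (e x : E) = f x) ∧ Dense W ∧
      ∀ x ∈ W, DifferentiableAt ℝ (‖·‖) (x.1 - y) ∧ DifferentiableAt ℝ (‖·‖) (f x - f y) := by
  have hD := bijOn_Dset hbij hiso hy
  let e : Dset y ≃ᵢ Dset (f y) := ⟨hD.equiv f, Isometry.of_dist_eq fun a b => by
    rw [Subtype.dist_eq, Subtype.dist_eq, dist_eq_norm, dist_eq_norm]
    exact hiso _ a.2.1 _ b.2.1⟩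
  have := (isLocallyClosed_Dset y).locallyCompactSpace
  refine ⟨e.toHomeomorph, _, fun x => rfl, (dense_differentiableAt_norm_sub y).inter_of_Gδ
    (isGδ_differentiableAt_norm_sub y)
    ((isGδ_differentiableAt_norm_sub (f y)).preimage e.continuous)
    ((dense_differentiableAt_norm_sub (f y)).preimage e.toHomeomorph.isOpenMap), fun x hx => hx⟩

/-- Pairs of directions that are limits of `(y - z) / ‖y - z‖` and `(f y - f z) / ‖f y - f z‖`
along a common sequence of points `z → y` of the sphere. -/
def tangentPairs (f : X → E) (y : X) : Set (X × E) :=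
  {p | ∃ z : ℕ → X, (∀ n, z n ∈ sphere (0 : X) 1 ∧ z n ≠ y) ∧ Tendsto z atTop (𝓝 y) ∧
    Tendsto (fun n => unitDir (y - z n)) atTop (𝓝 p.1) ∧
    Tendsto (fun n => unitDir (f y - f (z n))) atTop (𝓝 p.2)}

lemma norm_unitDir_le_one (v : X) : ‖unitDir v‖ ≤ 1 := by
  rw [unitDir, norm_smul, norm_inv, norm_norm]
  exact inv_mul_le_one

lemma exists_subseq_tendsto_unitDir [FiniteDimensional ℝ X] (v : ℕ → X) :
    ∃ u : X, ∃ φ : ℕ → ℕ, StrictMono φ ∧ Tendsto (fun n => unitDir (v (φ n))) atTop (𝓝 u) := by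
  have := FiniteDimensional.proper_real X
  obtain ⟨u, -, φ, hφ, h⟩ := (isCompact_closedBall (0 : X) 1).tendsto_subseq
    (x := fun n => unitDir (v n)) fun n => by simpa using norm_unitDir_le_one (v n)
  exact ⟨u, φ, hφ, h⟩

lemma fst_image_tangentPairs [FiniteDimensional ℝ E] :
    Prod.fst '' tangentPairs f y = tangentDirs y := by
  ext u
  constructor
  · rintro ⟨p, ⟨z, hz, hzy, h1, -⟩, rfl⟩
    exact ⟨z, hz, hzy, h1⟩
  · rintro ⟨z, hz, hzy, h1⟩
    obtain ⟨v, φ, hφ, hv⟩ := exists_subseq_tendsto_unitDir fun n => f y - f (z n)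
    exact ⟨(u, v), ⟨z ∘ φ, fun n => hz _, hzy.comp hφ.tendsto_atTop,
      h1.comp hφ.tendsto_atTop, hv⟩, rfl⟩

lemma snd_image_tangentPairs [FiniteDimensional ℝ X]
    (hbij : BijOn f (sphere (0 : X) 1) (sphere (0 : E) 1))
    (hiso : ∀ x ∈ sphere (0 : X) 1, ∀ x' ∈ sphere (0 : X) 1, ‖f x - f x'‖ = ‖x - x'‖)
    (hy : y ∈ sphere (0 : X) 1) : Prod.snd '' tangentPairs f y = tangentDirs (f y) := by
  ext v
  constructor
  · rintro ⟨p, ⟨z, hz, hzy, -, h2⟩, rfl⟩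
    exact ⟨fun n => f (z n), fun n => ⟨hbij.mapsTo (hz n).1,
      hbij.injOn.ne (hz n).1 hy (hz n).2⟩,
      (tendsto_map_iff hiso hy fun n => (hz n).1).2 hzy, h2⟩
  · rintro ⟨z', hz', hzy', h2⟩
    choose z hz hfz using fun n => hbij.surjOn (hz' n).1
    obtain rfl : (fun n => f (z n)) = z' := funext hfz
    have hzy := (tendsto_map_iff hiso hy hz).1 hzy'
    obtain ⟨u, φ, hφ, hu⟩ := exists_subseq_tendsto_unitDir fun n => y - z n
    exact ⟨(u, v), ⟨z ∘ φ, fun n => ⟨hz _, fun h => (hz' (φ n)).2 (congrArg f h)⟩,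
      hzy.comp hφ.tendsto_atTop, hu, h2.comp hφ.tendsto_atTop⟩, rfl⟩

lemma tendsto_difference_quotient {x u : X} (h : DifferentiableAt ℝ (‖·‖) (x - y)) {z : ℕ → X}
    (hz : Tendsto z atTop (𝓝 y)) (hu : Tendsto (fun n => unitDir (y - z n)) atTop (𝓝 u)) :
    Tendsto (fun n => ‖y - z n‖⁻¹ * (‖x - z n‖ - ‖x - y‖)) atTop
      (𝓝 (fderiv ℝ (‖·‖) (x - y) u)) := by
  have hd : Tendsto (fun n => y - z n) atTop (𝓝 0) := by
    simpa using (tendsto_const_nhds (x := y)).sub hz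
  simpa using h.hasFDerivAt.hasFDerivWithinAt.lim (s := univ) hd (by simp) hu

lemma fderiv_norm_eq_of_mem_tangentPairs
    (hiso : ∀ x ∈ sphere (0 : X) 1, ∀ x' ∈ sphere (0 : X) 1, ‖f x - f x'‖ = ‖x - x'‖)
    (hy : y ∈ sphere (0 : X) 1) {x : X} (hx : x ∈ sphere (0 : X) 1)
    (h1 : DifferentiableAt ℝ (‖·‖) (x - y)) (h2 : DifferentiableAt ℝ (‖·‖) (f x - f y))
    {p : X × E} (hp : p ∈ tangentPairs f y) :
    fderiv ℝ (‖·‖) (x - y) p.1 = fderiv ℝ (‖·‖) (f x - f y) p.2 := by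
  obtain ⟨z, hz, hzy, hu, hv⟩ := hp
  have hlim := tendsto_difference_quotient h2
    ((tendsto_map_iff hiso hy fun n => (hz n).1).2 hzy) hv
  simp only [hiso _ hx y hy, hiso _ hx _ (hz _).1, hiso y hy _ (hz _).1] at hlim
  exact tendsto_nhds_unique (tendsto_difference_quotient h1 hzy hu) hlim

lemma fst_eq_zero_iff_of_mem_span_tangentPairs [FiniteDimensional ℝ X] [FiniteDimensional ℝ E]
    (hbij : BijOn f (sphere (0 : X) 1) (sphere (0 : E) 1))
    (hiso : ∀ x ∈ sphere (0 : X) 1, ∀ x' ∈ sphere (0 : X) 1, ‖f x - f x'‖ = ‖x - x'‖)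
    (hy : y ∈ sphere (0 : X) 1) {p : X × E} (hp : p ∈ Submodule.span ℝ (tangentPairs f y)) :
    p.1 = 0 ↔ p.2 = 0 := by
  obtain ⟨e, W, he, hW, hdiff⟩ := exists_dense_differentiableAt_norm hbij hiso hy
  have key : ∀ x ∈ W,
      fderiv ℝ (‖·‖) (x.1 - y) p.1 = fderiv ℝ (‖·‖) (f x - f y) p.2 := by
    intro x hx
    induction hp using Submodule.span_induction with
    | mem p hp =>
      exact fderiv_norm_eq_of_mem_tangentPairs hiso hy x.2.1 (hdiff x hx).1 (hdiff x hx).2 hp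
    | zero => simp
    | add p q _ _ hp hq => simp [hp, hq]
    | smul a p _ hp => simp [hp]
  constructor
  · intro h
    refine eq_zero_of_fderiv_norm_sub_eq_zero (mem_sphere_zero_iff_norm.1 (hbij.mapsTo hy))
      (hW.preimage e.symm.isOpenMap) (fun v hv => ?_) fun v hv => ?_
    · simpa [← he] using (hdiff _ hv).2
    · simpa [← he, h] using (key _ hv).symm
  · intro h
    refine eq_zero_of_fderiv_norm_sub_eq_zero (mem_sphere_zero_iff_norm.1 hy) hW
      (fun x hx => (hdiff x hx).1) fun x hx => ?_
    rw [key x hx, h, map_zero]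

end SphereIsometry

/-- **Lemma 5, first part.** There is a linear map `T` representing the tangent action of
`f` at `y` which maps `span Λ_y` bijectively onto `span Λ_{f y}` (a linear isomorphism
between these subspaces). -/
theorem lemma5_iso {X E : Type*} [NormedAddCommGroup X] [NormedSpace ℝ X]
    [FiniteDimensional ℝ X] [NormedAddCommGroup E] [NormedSpace ℝ E] [FiniteDimensional ℝ E]
    (f : X → E) (hbij : Set.BijOn f (sphere (0 : X) 1) (sphere (0 : E) 1))
    (hiso : ∀ x ∈ sphere (0 : X) 1, ∀ x' ∈ sphere (0 : X) 1, ‖f x - f x'‖ = ‖x - x'‖)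
    (y : X) (hy : y ∈ sphere (0 : X) 1) :
    ∃ T : X →ₗ[ℝ] E, RepTangent f y T ∧
      Set.BijOn T (Submodule.span ℝ (tangentDirs y) : Set X)
        (Submodule.span ℝ (tangentDirs (f y)) : Set E) := by
  set P := Submodule.span ℝ (tangentPairs f y)
  have hfst : P.map (LinearMap.fst ℝ X E) = Submodule.span ℝ (tangentDirs y) := by
    rw [Submodule.map_span, ← fst_image_tangentPairs (f := f)]; rfl
  have hsnd : P.map (LinearMap.snd ℝ X E) = Submodule.span ℝ (tangentDirs (f y)) := by
    rw [Submodule.map_span, ← snd_image_tangentPairs hbij hiso hy]; rfl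
  have hzero : ∀ p ∈ P, p.1 = 0 ↔ p.2 = 0 := fun p hp =>
    fst_eq_zero_iff_of_mem_span_tangentPairs hbij hiso hy hp
  have hker : LinearMap.ker (LinearMap.fst ℝ X E ∘ₗ P.subtype) = ⊥ := by
    refine LinearMap.ker_eq_bot'.2 fun p hp => Subtype.ext (Prod.ext hp ?_)
    exact (hzero p p.2).1 hp
  obtain ⟨ρ, hρ⟩ := LinearMap.exists_leftInverse_of_injective _ hker
  have hT : ∀ p ∈ P, (LinearMap.snd ℝ X E ∘ₗ P.subtype ∘ₗ ρ) p.1 = p.2 := fun p hp =>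
    congrArg (fun q : P => q.1.2) (LinearMap.congr_fun hρ ⟨p, hp⟩)
  refine ⟨LinearMap.snd ℝ X E ∘ₗ P.subtype ∘ₗ ρ, fun z u hz hzy hu => ?_, ?_, ?_, ?_⟩
  · refine tendsto_of_subseq_tendsto fun ns hns => ?_
    obtain ⟨v, φ, hφ, hv⟩ := exists_subseq_tendsto_unitDir fun n => f y - f (z (ns n))
    refine ⟨φ, ?_⟩
    have hφ' := hns.comp hφ.tendsto_atTop
    have hmem : (u, v) ∈ tangentPairs f y :=
      ⟨fun n => z (ns (φ n)), fun n => hz _, hzy.comp hφ', hu.comp hφ', hv⟩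
    rwa [hT _ (Submodule.subset_span hmem)]
  · intro u hu
    rw [← hfst] at hu
    obtain ⟨p, hp, rfl⟩ := hu
    rw [← hsnd]
    exact ⟨p, hp, (hT p hp).symm⟩
  · intro u hu u' hu' h
    rw [← hfst] at hu hu'
    obtain ⟨p, hp, rfl⟩ := hu
    obtain ⟨q, hq, rfl⟩ := hu'
    have h' : p.2 = q.2 := (hT p hp).symm.trans (h.trans (hT q hq))
    exact sub_eq_zero.1 ((hzero (p - q) (P.sub_mem hp hq)).2 (sub_eq_zero.2 h'))
  · intro v hv
    rw [← hsnd] at hv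
    obtain ⟨p, hp, rfl⟩ := hv
    refine ⟨p.1, ?_, hT p hp⟩
    rw [← hfst]
    exact ⟨p, hp, rfl⟩
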